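/- Let χ₁ and χ₂ be unit vectors in ℂ²⊗ℂ² with |χ₁⟩⟨χ₁| ≠ |χ₂⟩⟨χ₂|, and suppose Tr₁ |χ₁⟩⟨χ₁| = Tr₁ |χ₂⟩⟨χ₂| and Tr₂ |χ₁⟩⟨χ₁| = Tr₂ |χ₂⟩⟨χ₂| (the two pure two-qubit states, whether mutually orthogonal or not, mask each other). Then for every p ∈ [0,1] with p ≠ 1/2, the mixture p|χ₁⟩⟨χ₁| + (1−p)|χ₂⟩⟨χ₂| is NOT separable. That is, entanglement is indispensable for masking an arbitrary set of two single-qubit states, regardless of their mixednesses and mutual commutativity: the masked states remain entangled unless the input state is an equal mixture of the two pure states. -/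

import Mathlib

open Matrix Kronecker Polynomial ComplexOrder

noncomputable section

/-- Partial trace over the first subsystem of a two-qubit (4×4) matrix. -/
def ptr1 (M : Matrix (Fin 2 × Fin 2) (Fin 2 × Fin 2) ℂ) : Matrix (Fin 2) (Fin 2) ℂ :=
  Matrix.of fun j l => ∑ i, M (i, j) (i, l)

/-- Partial trace over the second subsystem of a two-qubit (4×4) matrix. -/
def ptr2 (M : Matrix (Fin 2 × Fin 2) (Fin 2 × Fin 2) ℂ) : Matrix (Fin 2) (Fin 2) ℂ :=
  Matrix.of fun i k => ∑ j, M (i, j) (k, j)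

/-- Rank-one projection |v⟩⟨v| of a qubit vector. -/
def proj2 (v : Fin 2 → ℂ) : Matrix (Fin 2) (Fin 2) ℂ :=
  Matrix.of fun i j => v i * star (v j)

/-- Rank-one projection |v⟩⟨v| of a two-qubit vector. -/
def proj4 (v : Fin 2 × Fin 2 → ℂ) : Matrix (Fin 2 × Fin 2) (Fin 2 × Fin 2) ℂ :=
  Matrix.of fun p q => v p * star (v q)

/-- Kronecker (tensor) product of two qubit vectors. -/
def tens (a b : Fin 2 → ℂ) : Fin 2 × Fin 2 → ℂ := fun p => a p.1 * b p.2

/-- Unit (normalized) vector. -/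
def UnitVec {α : Type*} [Fintype α] (v : α → ℂ) : Prop := ∑ i, v i * star (v i) = 1

/-- Hermitian inner product of two-qubit vectors. -/
def inner4 (v w : Fin 2 × Fin 2 → ℂ) : ℂ := ∑ p, star (v p) * w p

/-- A 2×2 density matrix: positive semidefinite with unit trace. -/
def IsDensity2 (A : Matrix (Fin 2) (Fin 2) ℂ) : Prop := A.PosSemidef ∧ A.trace = 1

/-- Separability of a two-qubit density matrix: a finite convex combination of
Kronecker products of 2×2 density matrices. -/
def Separable4 (ρ : Matrix (Fin 2 × Fin 2) (Fin 2 × Fin 2) ℂ) : Prop :=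
  ∃ (n : ℕ) (w : Fin n → ℝ) (A B : Fin n → Matrix (Fin 2) (Fin 2) ℂ),
    (∀ i, 0 ≤ w i) ∧ (∑ i, w i = 1) ∧
    (∀ i, IsDensity2 (A i)) ∧ (∀ i, IsDensity2 (B i)) ∧
    ρ = ∑ i, (w i : ℂ) • (A i ⊗ₖ B i)

/-- Standard basis vector e₀ of ℂ². -/
def e₀ : Fin 2 → ℂ := ![1, 0]

/-- Standard basis vector e₁ of ℂ². -/
def e₁ : Fin 2 → ℂ := ![0, 1]

/-- The masked mixture ρ(p) = p|χ₁⟩⟨χ₁| + (1−p)|χ₂⟩⟨χ₂|. -/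
def mix (χ₁ χ₂ : Fin 2 × Fin 2 → ℂ) (p : ℝ) : Matrix (Fin 2 × Fin 2) (Fin 2 × Fin 2) ℂ :=
  (p : ℂ) • proj4 χ₁ + (1 - (p : ℂ)) • proj4 χ₂

lemma comb_aux {ι : Type*} [Fintype ι] (a b : ι → ℂ) (d c e : ℂ) (hd : d ≠ 0)
    (hde : ‖d‖ = ‖e‖) (h : ∀ m, d * a m ^ 2 + c * (a m * b m) + e * b m ^ 2 = 0)
    (h0 : ∑ m, a m * star (b m) = 0) :
    ∑ m, a m * star (a m) = ∑ m, b m * star (b m) := by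
  classical
  obtain ⟨s, hs⟩ := IsAlgClosed.exists_pow_nat_eq (c ^ 2 - 4 * d * e) (n := 2) (by norm_num)
  obtain ⟨z, hz⟩ : ∃ z, z = (-c + s) / (2 * d) := ⟨_, rfl⟩
  obtain ⟨y, hy⟩ : ∃ y, y = (-c - s) / (2 * d) := ⟨_, rfl⟩
  have hsum : d * (z + y) = -c := by rw [hz, hy]; field_simp; ring
  have hprod : d * (z * y) = e := by
    rw [hz, hy]; field_simp; linear_combination -hs
  have hn : ‖z‖ * ‖y‖ = 1 := by
    have h1 : ‖d‖ * (‖z‖ * ‖y‖) = ‖d‖ := by rw [← norm_mul, ← norm_mul, hprod, hde]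
    have h2 : ‖d‖ ≠ 0 := norm_ne_zero_iff.mpr hd
    exact mul_left_cancel₀ h2 (by linarith)
  have hcase : ∀ m, a m = z * b m ∨ a m = y * b m := by
    intro m
    have : d * ((a m - z * b m) * (a m - y * b m)) = 0 := by
      linear_combination h m - a m * b m * hsum + b m ^ 2 * hprod
    rcases mul_eq_zero.mp ((mul_eq_zero.mp this).resolve_left hd) with h | h
    · left; linear_combination h
    · right; linear_combination h
  obtain ⟨t, ht⟩ : ∃ t : ι → ℂ, ∀ m, t m = if a m = z * b m then z else y := ⟨_, fun _ => rfl⟩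
  obtain ⟨M, hM⟩ : ∃ M : ℝ, M = ∑ m, if a m = z * b m then ‖b m‖ ^ 2 else 0 := ⟨_, rfl⟩
  obtain ⟨N, hN⟩ : ∃ N : ℝ, N = ∑ m, if a m = z * b m then 0 else ‖b m‖ ^ 2 := ⟨_, rfl⟩
  have hM0 : 0 ≤ M := by
    rw [hM]; refine Finset.sum_nonneg fun m _ => ?_; split_ifs <;> positivity
  have hN0 : 0 ≤ N := by
    rw [hN]; refine Finset.sum_nonneg fun m _ => ?_; split_ifs <;> positivity
  have hss : ∀ x : ℂ, x * star x = ((‖x‖ ^ 2 : ℝ) : ℂ) := by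
    intro x; push_cast; exact Complex.mul_conj' x
  have e1 : ∑ m, a m * star (b m) = z * M + y * N := by
    rw [hM, hN]; push_cast; rw [Finset.mul_sum, Finset.mul_sum, ← Finset.sum_add_distrib]
    refine Finset.sum_congr rfl fun m _ => ?_
    split_ifs with h
    · have := hss (b m); push_cast at this; push_cast; rw [← this, h]; ring
    · have := hss (b m); push_cast at this; push_cast
      rw [← this]; rw [(hcase m).resolve_left h]; ring
  have e2 : ∑ m, b m * star (b m) = ((M + N : ℝ) : ℂ) := by
    rw [hM, hN, ← Finset.sum_add_distrib]; push_cast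
    refine Finset.sum_congr rfl fun m _ => ?_
    rw [hss]; split_ifs <;> simp
  have e3 : ∑ m, a m * star (a m) = ((‖z‖ ^ 2 * M + ‖y‖ ^ 2 * N : ℝ) : ℂ) := by
    rw [hM, hN, Finset.mul_sum, Finset.mul_sum, ← Finset.sum_add_distrib]; push_cast
    refine Finset.sum_congr rfl fun m _ => ?_
    rw [hss]
    split_ifs with h
    · rw [h, norm_mul]; push_cast; ring
    · rw [(hcase m).resolve_left h, norm_mul]; push_cast; ring
  have e4 : ‖z‖ * M = ‖y‖ * N := by
    have : z * M = -(y * N) := by rw [h0] at e1; linear_combination -e1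
    have := congrArg norm this
    rwa [norm_neg, norm_mul, norm_mul, Complex.norm_of_nonneg hM0, Complex.norm_of_nonneg hN0]
      at this
  rw [e2, e3]
  congr 1
  linear_combination (‖z‖ - ‖y‖) * e4 + (M + N) * hn

open scoped MatrixOrder Matrix.Norms.L2Operator in
lemma sep_decomp {ρ : Matrix (Fin 2 × Fin 2) (Fin 2 × Fin 2) ℂ} (h : Separable4 ρ) :
    ∃ (n : ℕ) (v : Fin n × Fin 2 × Fin 2 → (Fin 2 × Fin 2 → ℂ)),
      (∀ m, v m (0, 0) * v m (1, 1) = v m (0, 1) * v m (1, 0)) ∧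
      ∀ p q, ρ p q = ∑ m, v m p * star (v m q) := by
  obtain ⟨n, w, A, B, hw, -, hA, hB, rfl⟩ := h
  have key : ∀ A : Matrix (Fin 2) (Fin 2) ℂ, IsDensity2 A →
      ∃ C : Matrix (Fin 2) (Fin 2) ℂ, ∀ i k, A i k = ∑ s, C i s * star (C k s) := by
    intro A hA
    obtain ⟨C, hC⟩ := CStarAlgebra.nonneg_iff_eq_mul_star_self.mp hA.1.nonneg
    exact ⟨C, fun i k => by rw [hC]; simp [Matrix.mul_apply, Matrix.star_apply]⟩
  choose C hC using fun i => key _ (hA i)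
  choose D hD using fun i => key _ (hB i)
  refine ⟨n, fun m p => (Real.sqrt (w m.1) : ℂ) * (C m.1 p.1 m.2.1 * D m.1 p.2 m.2.2), ?_, ?_⟩
  · intro m; ring
  · intro p q
    rw [Fintype.sum_prod_type, Matrix.sum_apply]
    refine Finset.sum_congr rfl fun k _ => ?_
    have hs : ((Real.sqrt (w k) : ℝ) : ℂ) * (Real.sqrt (w k) : ℝ) = (w k : ℂ) := by
      rw [← Complex.ofReal_mul, Real.mul_self_sqrt (hw k)]
    simp only [Matrix.smul_apply, Matrix.kroneckerMap_apply, hC, hD, Fintype.sum_prod_type,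
      Fin.sum_univ_two, smul_eq_mul, ← hs, star_mul', Complex.star_def, Complex.conj_ofReal]
    ring

lemma prod_of_det {χ : Fin 2 × Fin 2 → ℂ} (h : UnitVec χ)
    (hd : χ (0, 0) * χ (1, 1) = χ (0, 1) * χ (1, 0)) (i j k l : Fin 2) :
    proj4 χ (i, j) (k, l) = ptr2 (proj4 χ) i k * ptr1 (proj4 χ) j l := by
  have hx : ∀ i j n m, χ (i, m) * χ (n, j) = χ (i, j) * χ (n, m) := by
    intro i j n m
    fin_cases i <;> fin_cases j <;> fin_cases n <;> fin_cases m <;> simp <;>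
      first | ring1 | linear_combination hd | linear_combination -hd
  have h1 : ∑ m, ∑ n, χ (n, m) * star (χ (n, m)) = 1 := by
    rw [Finset.sum_comm, ← Fintype.sum_prod_type']; exact h
  calc proj4 χ (i, j) (k, l)
      = χ (i, j) * star (χ (k, l)) * ∑ m, ∑ n, χ (n, m) * star (χ (n, m)) := by
        rw [h1, mul_one]; rfl
    _ = ∑ m, ∑ n, (χ (i, m) * star (χ (k, m))) * (χ (n, j) * star (χ (n, l))) := by
        simp only [Finset.mul_sum]
        refine Finset.sum_congr rfl fun m _ => Finset.sum_congr rfl fun n _ => ?_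
        have a1 := hx i j n m
        have a2 := congrArg star (hx k l n m)
        simp only [star_mul'] at a2
        linear_combination -(star (χ (k, l)) * star (χ (n, m))) * a1 - χ (i, m) * χ (n, j) * a2
    _ = _ := by
        simp only [ptr1, ptr2, proj4, Matrix.of_apply, Finset.sum_mul_sum]

lemma det_norm (χ : Fin 2 × Fin 2 → ℂ) :
    ((‖χ (0, 0) * χ (1, 1) - χ (0, 1) * χ (1, 0)‖ ^ 2 : ℝ) : ℂ) =
      ptr2 (proj4 χ) 0 0 * ptr2 (proj4 χ) 1 1 - ptr2 (proj4 χ) 0 1 * ptr2 (proj4 χ) 1 0 := by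
  push_cast
  rw [← Complex.mul_conj']
  simp only [ptr2, proj4, Matrix.of_apply, Fin.sum_univ_two, map_sub, map_mul, Complex.star_def]
  ring

lemma lin_form {ι : Type*} [Fintype ι] {χ₁ χ₂ : Fin 2 × Fin 2 → ℂ} {p : ℝ}
    {v : ι → Fin 2 × Fin 2 → ℂ}
    (hv : ∀ r q, mix χ₁ χ₂ p r q = ∑ m, v m r * star (v m q))
    (f g : (Fin 2 × Fin 2 → ℂ) →ₗ[ℂ] ℂ) :
    ∑ m, f (v m) * star (g (v m)) =
      p * (f χ₁ * star (g χ₁)) + (1 - p) * (f χ₂ * star (g χ₂)) := by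
  have hf : ∀ (f : (Fin 2 × Fin 2 → ℂ) →ₗ[ℂ] ℂ) x, f x = ∑ r, x r * f (Pi.single r 1) := by
    intro f x
    conv_lhs => rw [pi_eq_sum_univ' x]
    simp [map_sum, smul_eq_mul]
  have e : ∀ x : Fin 2 × Fin 2 → ℂ, f x * star (g x) =
      ∑ r, ∑ q, (f (Pi.single r 1) * star (g (Pi.single q 1))) * (x r * star (x q)) := by
    intro x
    rw [hf f x, hf g x, star_sum, Finset.sum_mul_sum]
    refine Finset.sum_congr rfl fun r _ => Finset.sum_congr rfl fun q _ => ?_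
    rw [star_mul']; ring
  simp only [e]
  rw [Finset.sum_comm]
  simp only [Finset.mul_sum, ← Finset.sum_add_distrib]
  refine Finset.sum_congr rfl fun r _ => ?_
  rw [Finset.sum_comm]
  refine Finset.sum_congr rfl fun q _ => ?_
  rw [← Finset.mul_sum, ← hv]
  simp only [mix, proj4, Matrix.add_apply, Matrix.smul_apply, Matrix.of_apply, smul_eq_mul]
  ring

/-- for any two distinct pure two-qubit states (orthogonal or not) that
mask each other, every unequal mixture p ≠ 1/2 of the masked states is entangled
(not separable): entanglement is indispensable for masking. -/
theorem entanglement_indispensable_for_masking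
    (χ₁ χ₂ : Fin 2 × Fin 2 → ℂ)
    (h₁ : UnitVec χ₁) (h₂ : UnitVec χ₂)
    (hdist : proj4 χ₁ ≠ proj4 χ₂)
    (hmask1 : ptr1 (proj4 χ₁) = ptr1 (proj4 χ₂))
    (hmask2 : ptr2 (proj4 χ₁) = ptr2 (proj4 χ₂))
    (p : ℝ) (hp : p ∈ Set.Icc (0 : ℝ) 1) (hp' : p ≠ 1/2) :
    ¬ Separable4 (mix χ₁ χ₂ p) := by
  intro hsep
  obtain ⟨n, v, hdet, hv⟩ := sep_decomp hsep
  have hn : ‖χ₁ (0, 0) * χ₁ (1, 1) - χ₁ (0, 1) * χ₁ (1, 0)‖ =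
      ‖χ₂ (0, 0) * χ₂ (1, 1) - χ₂ (0, 1) * χ₂ (1, 0)‖ := by
    have := det_norm χ₁
    rw [hmask2, ← det_norm χ₂] at this
    exact (sq_eq_sq₀ (norm_nonneg _) (norm_nonneg _)).mp (Complex.ofReal_injective this)
  have hd : χ₁ (0, 0) * χ₁ (1, 1) - χ₁ (0, 1) * χ₁ (1, 0) ≠ 0 := by
    intro h0
    have h0' : χ₂ (0, 0) * χ₂ (1, 1) - χ₂ (0, 1) * χ₂ (1, 0) = 0 := by
      rw [h0, norm_zero] at hn; exact norm_eq_zero.mp hn.symm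
    apply hdist
    ext ⟨i, j⟩ ⟨k, l⟩
    rw [prod_of_det h₁ (sub_eq_zero.mp h0), prod_of_det h₂ (sub_eq_zero.mp h0'), hmask1, hmask2]
  have hχ : χ₁ ≠ 0 := by
    rintro rfl; simp at hd
  have hli : LinearIndependent ℂ ![χ₁, χ₂] := by
    rw [LinearIndependent.pair_iff' hχ]
    intro a ha
    apply hdist
    have haa : a * star a = 1 := by
      unfold UnitVec at h₁ h₂
      rw [← h₂, ← ha]
      simp only [Pi.smul_apply, smul_eq_mul, star_mul']
      rw [← mul_one (a * star a), ← h₁, Finset.mul_sum]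
      refine Finset.sum_congr rfl fun i _ => by ring
    ext r q
    simp only [proj4, Matrix.of_apply, ← ha, Pi.smul_apply, smul_eq_mul, star_mul']
    linear_combination -(χ₁ r * star (χ₁ q)) * haa
  have hspan : ∀ m, v m ∈ Submodule.span ℂ (Set.range ![χ₁, χ₂]) := by
    intro m
    by_contra hm
    obtain ⟨f, hf, hle⟩ := Submodule.exists_le_ker_of_notMem hm
    have z1 : f χ₁ = 0 := hle (Submodule.subset_span ⟨0, rfl⟩)
    have z2 : f χ₂ = 0 := hle (Submodule.subset_span ⟨1, rfl⟩)
    have hs := lin_form hv f f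
    rw [z1, z2] at hs
    simp only [zero_mul, mul_zero, add_zero] at hs
    have := (Finset.sum_eq_zero_iff_of_nonneg (fun i _ => mul_star_self_nonneg (f (v i)))).mp hs
      m (Finset.mem_univ m)
    rw [mul_eq_zero, star_eq_zero, or_self] at this
    exact hf this
  obtain ⟨L, hL⟩ := LinearMap.exists_extend (hli.repr : _ →ₗ[ℂ] (Fin 2 →₀ ℂ))
  have hLx : ∀ x : Submodule.span ℂ (Set.range ![χ₁, χ₂]), L x = hli.repr x := by
    intro x; rw [← hL]; rfl
  have hL1 : L χ₁ = Finsupp.single 0 1 := by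
    rw [hLx ⟨χ₁, Submodule.subset_span ⟨0, rfl⟩⟩]
    exact hli.repr_eq_single 0 _ rfl
  have hL2 : L χ₂ = Finsupp.single 1 1 := by
    rw [hLx ⟨χ₂, Submodule.subset_span ⟨1, rfl⟩⟩]
    exact hli.repr_eq_single 1 _ rfl
  obtain ⟨f, hf⟩ : ∃ f : (Fin 2 × Fin 2 → ℂ) →ₗ[ℂ] ℂ, f = Finsupp.lapply 0 ∘ₗ L := ⟨_, rfl⟩
  obtain ⟨g, hg⟩ : ∃ g : (Fin 2 × Fin 2 → ℂ) →ₗ[ℂ] ℂ, g = Finsupp.lapply 1 ∘ₗ L := ⟨_, rfl⟩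
  have f1 : f χ₁ = 1 := by simp [hf, hL1]
  have f2 : f χ₂ = 0 := by simp [hf, hL2]
  have g1 : g χ₁ = 0 := by simp [hg, hL1]
  have g2 : g χ₂ = 1 := by simp [hg, hL2]
  have hdec : ∀ m r, v m r = f (v m) * χ₁ r + g (v m) * χ₂ r := by
    intro m r
    have := hspan m
    simp only [Matrix.range_cons, Matrix.range_empty, Set.union_empty, Set.singleton_union] at this
    obtain ⟨a, b, hab⟩ := Submodule.mem_span_pair.mp this
    rw [← hab]
    simp [f1, f2, g1, g2]
  have hfin := comb_aux (fun m => f (v m)) (fun m => g (v m)) _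
    (χ₁ (0, 0) * χ₂ (1, 1) + χ₂ (0, 0) * χ₁ (1, 1) - χ₁ (0, 1) * χ₂ (1, 0)
      - χ₂ (0, 1) * χ₁ (1, 0)) _ hd hn (by
      intro m
      have := hdet m
      rw [hdec m (0, 0), hdec m (0, 1), hdec m (1, 0), hdec m (1, 1)] at this
      linear_combination this) (by
      rw [lin_form hv f g, f1, f2, g1, g2]; simp)
  rw [lin_form hv f f, lin_form hv g g, f1, f2, g1, g2] at hfin
  simp only [star_one, star_zero, mul_one, mul_zero, add_zero, zero_add] at hfin
  apply hp'
  have : p = 1 - p := by exact_mod_cast hfin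
  linarith

end
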